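/- Fix integers K ≥ 1, θ > 0, Δt > 0, matrices Σ ∈ ℝ^{m×d} with ΣΣᵀ positive definite, A ∈ ℝ^{m×n}, a ∈ ℝ^m, Ξ ∈ ℝ^d, Λ ∈ ℝ^{n×d}, b ∈ ℝ^n, B̃ ∈ ℝ^{n×n}, c ∈ ℝ, C ∈ ℝ^n, and symmetric positive definite matrices Ψ_k ∈ ℝ^{m×m} for k = 0, …, K−1. Define symmetric matrices P_k ∈ ℝ^{n×n}, vectors p_k ∈ ℝ^n, and reals r_k by the backward recursions: P_K = 0, p_K = 0, r_K = 0; and for k = K−1, …, 0, with 𝒜_{k+1} := ΛᵀP_{k+1}ΛΔt − I_d and ℬ_{k+1} := θΣᵀ(ΣΣᵀ)⁻¹Σ − 𝒜_{k+1}: P_k = −θAᵀ(ΣΣᵀ)⁻¹AΔt + θ²Aᵀ(ΣΣᵀ)⁻¹Σℬ_{k+1}⁻¹Σᵀ(ΣΣᵀ)⁻¹AΔt − 2θAᵀ(ΣΣᵀ)⁻¹Σℬ_{k+1}⁻¹ΛᵀP_{k+1}B̃Δt + B̃ᵀP_{k+1}Λℬ_{k+1}⁻¹ΛᵀP_{k+1}B̃Δt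 + B̃ᵀP_{k+1}B̃ (symmetrized), p_k = −θAᵀ(ΣΣᵀ)⁻¹aΔt + (−θAᵀ(ΣΣᵀ)⁻¹Σ + B̃ᵀP_{k+1}Λ)ℬ_{k+1}⁻¹(−θΣᵀ(ΣΣᵀ)⁻¹a + Λᵀ(P_{k+1}bΔt + p_{k+1}) + θΞ)Δt + (B̃ᵀ(P_{k+1}b + p_{k+1}/Δt) + θC)Δt, and r_k = r_{k+1} − (θ/2)aᵀ(ΣΣᵀ)⁻¹aΔt + (1/2)(−θaᵀ(ΣΣᵀ)⁻¹Σ + bᵀP_{k+1}ΛΔt + p_{k+1}ᵀΛ + θΞᵀ)ℬ_{k+1}⁻¹(−θΣᵀ(ΣΣᵀ)⁻¹a + ΛᵀP_{k+1}bΔt + Λᵀp_{k+1} + θΞ)Δt + ((1/2)bᵀP_{k+1}bΔt + bᵀp_{k+1} + θc + (θ/2)tr(Ψ_kΣΣᵀ) − (θ/2)ΞᵀΞ + (1/2)tr(ΛᵀP_{k+1}Λ))Δt. Assume for every k = 0, …, K−1 that 𝒜_{k+1} is negative definite and Ψ_k⁻¹ − θΔt·Σ(I_d − θ𝒜_{k+1}⁻¹)Σᵀ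 is positive definite. Define value functions u_K(x) := 0 and, for k = K−1, …, 0, u_k(x) := inf over h ∈ ℝ^m of sup over (γ, η) ∈ ℝ^d × ℝ^m of { θ·g_k(x,h,η,γ)·Δt + ∫_{ℝ^d} u_{k+1}(bΔt + B̃x + ΛγΔt + Λw) dN(0, Δt·I_d)(w) }, where g_k(x,h,η,γ) := (1/2)(h+η)ᵀΣΣᵀ(h+η) + (1/2)tr(Ψ_kΣΣᵀ) − (h+η)ᵀa − (1/2)ΞᵀΞ + c − ((h+η)ᵀA − Cᵀ)x − ((h+η)ᵀΣ − Ξᵀ)γ − (1/(2θ))γᵀγ − (1/(2θΔt))ηᵀΨ_k⁻¹η. Then for every k = 0, …, K and every x ∈ ℝ^n, u_k(x) = (1/2)xᵀP_kx + xᵀp_k + r_k. -/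

import Mathlib

open MeasureTheory Matrix

/-- The multivariate Gaussian measure `N(μ, Ψ)` on `ℝ^d`, given by its density
with respect to Lebesgue measure. -/
noncomputable def gaussianMeasure {d : ℕ} (μ : Fin d → ℝ) (Ψ : Matrix (Fin d) (Fin d) ℝ) :
    Measure (Fin d → ℝ) :=
  volume.withDensity fun h =>
    ENNReal.ofReal ((Real.sqrt ((2 * Real.pi) ^ d * Ψ.det))⁻¹ *
      Real.exp (-(1 / 2 : ℝ) * ((h - μ) ⬝ᵥ (Ψ⁻¹ *ᵥ (h - μ)))))

/-- `ℬ = θΣᵀ(ΣΣᵀ)⁻¹Σ − 𝒜` with `𝒜 = ΛᵀPΛΔt − I_d`, for next-period coefficient `P`. -/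
noncomputable def calB {m n d : ℕ} (θ Δt : ℝ) (S : Matrix (Fin m) (Fin d) ℝ)
    (Λ : Matrix (Fin n) (Fin d) ℝ) (P : Matrix (Fin n) (Fin n) ℝ) :
    Matrix (Fin d) (Fin d) ℝ :=
  θ • (Sᵀ * (S * Sᵀ)⁻¹ * S) - (Δt • (Λᵀ * P * Λ) - 1)

/-- One step of the backward recursion for the quadratic coefficient `P_k`
(before symmetrization), as a function of the next-period coefficient `P`. -/
noncomputable def Pstep {m n d : ℕ} (θ Δt : ℝ) (S : Matrix (Fin m) (Fin d) ℝ)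
    (A : Matrix (Fin m) (Fin n) ℝ) (Λ : Matrix (Fin n) (Fin d) ℝ)
    (Bt : Matrix (Fin n) (Fin n) ℝ) (P : Matrix (Fin n) (Fin n) ℝ) :
    Matrix (Fin n) (Fin n) ℝ :=
  (-(θ * Δt)) • (Aᵀ * (S * Sᵀ)⁻¹ * A)
    + (θ ^ 2 * Δt) • (Aᵀ * (S * Sᵀ)⁻¹ * S * (calB θ Δt S Λ P)⁻¹ * Sᵀ * (S * Sᵀ)⁻¹ * A)
    - (2 * θ * Δt) • (Aᵀ * (S * Sᵀ)⁻¹ * S * (calB θ Δt S Λ P)⁻¹ * Λᵀ * P * Bt)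
    + Δt • (Btᵀ * P * Λ * (calB θ Δt S Λ P)⁻¹ * Λᵀ * P * Bt)
    + Btᵀ * P * Bt

/-- One step of the backward recursion for the linear coefficient `p_k`. -/
noncomputable def pstep {m n d : ℕ} (θ Δt : ℝ) (S : Matrix (Fin m) (Fin d) ℝ)
    (A : Matrix (Fin m) (Fin n) ℝ) (a : Fin m → ℝ) (Ξ : Fin d → ℝ)
    (Λ : Matrix (Fin n) (Fin d) ℝ) (b : Fin n → ℝ) (Bt : Matrix (Fin n) (Fin n) ℝ)
    (C : Fin n → ℝ) (P : Matrix (Fin n) (Fin n) ℝ) (p : Fin n → ℝ) :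
    Fin n → ℝ :=
  (-(θ * Δt)) • (Aᵀ *ᵥ ((S * Sᵀ)⁻¹ *ᵥ a))
    + Δt • ((((-θ) • (Aᵀ * (S * Sᵀ)⁻¹ * S)) + Btᵀ * P * Λ) *ᵥ
        ((calB θ Δt S Λ P)⁻¹ *ᵥ
          ((-θ) • (Sᵀ *ᵥ ((S * Sᵀ)⁻¹ *ᵥ a)) + Λᵀ *ᵥ (Δt • (P *ᵥ b) + p) + θ • Ξ)))
    + Δt • (Btᵀ *ᵥ (P *ᵥ b + Δt⁻¹ • p) + θ • C)

/-- One step of the backward recursion for the constant coefficient `r_k`. -/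
noncomputable def rstep {m n d : ℕ} (θ Δt : ℝ) (S : Matrix (Fin m) (Fin d) ℝ)
    (a : Fin m → ℝ) (Ξ : Fin d → ℝ) (Λ : Matrix (Fin n) (Fin d) ℝ) (b : Fin n → ℝ)
    (c : ℝ) (Ψ : Matrix (Fin m) (Fin m) ℝ) (P : Matrix (Fin n) (Fin n) ℝ)
    (p : Fin n → ℝ) (r : ℝ) : ℝ :=
  r - (θ / 2) * (a ⬝ᵥ ((S * Sᵀ)⁻¹ *ᵥ a)) * Δt
    + (1 / 2 : ℝ) *
        (((-θ) • (a ᵥ* ((S * Sᵀ)⁻¹ * S)) + Δt • (b ᵥ* (P * Λ)) + (p ᵥ* Λ) + θ • Ξ) ⬝ᵥ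
          ((calB θ Δt S Λ P)⁻¹ *ᵥ
            ((-θ) • (Sᵀ *ᵥ ((S * Sᵀ)⁻¹ *ᵥ a)) + Δt • (Λᵀ *ᵥ (P *ᵥ b)) + Λᵀ *ᵥ p
              + θ • Ξ))) * Δt
    + ((1 / 2 : ℝ) * (b ⬝ᵥ (P *ᵥ b)) * Δt + b ⬝ᵥ p + θ * c
        + (θ / 2) * (Ψ * (S * Sᵀ)).trace - (θ / 2) * (Ξ ⬝ᵥ Ξ)
        + (1 / 2 : ℝ) * (Λᵀ * P * Λ).trace) * Δt

/-- The instantaneous reward `g_k` of the relative-entropy-penalized stochastic game. -/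
noncomputable def gFun {m n d : ℕ} (θ Δt : ℝ) (S : Matrix (Fin m) (Fin d) ℝ)
    (A : Matrix (Fin m) (Fin n) ℝ) (a : Fin m → ℝ) (Ξ : Fin d → ℝ)
    (c : ℝ) (C : Fin n → ℝ) (Ψ : Matrix (Fin m) (Fin m) ℝ)
    (x : Fin n → ℝ) (h : Fin m → ℝ) (η : Fin m → ℝ) (γ : Fin d → ℝ) : ℝ :=
  (1 / 2 : ℝ) * ((h + η) ⬝ᵥ ((S * Sᵀ) *ᵥ (h + η))) + (1 / 2 : ℝ) * (Ψ * (S * Sᵀ)).trace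
    - (h + η) ⬝ᵥ a - (1 / 2 : ℝ) * (Ξ ⬝ᵥ Ξ) + c
    - (((h + η) ᵥ* A) - C) ⬝ᵥ x
    - ((Sᵀ *ᵥ (h + η)) - Ξ) ⬝ᵥ γ
    - (1 / (2 * θ)) * (γ ⬝ᵥ γ)
    - (1 / (2 * θ * Δt)) * (η ⬝ᵥ (Ψ⁻¹ *ᵥ η))

open ProbabilityTheory in
lemma gaussianMeasure_eq_pi {d : ℕ} (t : ℝ) (ht : 0 < t) :
    gaussianMeasure (0 : Fin d → ℝ) (t • (1 : Matrix (Fin d) (Fin d) ℝ))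
      = Measure.pi (fun _ : Fin d => gaussianReal 0 t.toNNReal) := by
  have hv : t.toNNReal ≠ 0 := by simpa using ht
  have hc : (t.toNNReal : ℝ) = t := Real.coe_toNNReal t ht.le
  have hinv : (t • (1 : Matrix (Fin d) (Fin d) ℝ))⁻¹ = t⁻¹ • (1 : Matrix (Fin d) (Fin d) ℝ) := by
    apply Matrix.inv_eq_right_inv
    simp [ht.ne']
  have hdens : ∀ w : Fin d → ℝ,
      (Real.sqrt ((2 * Real.pi) ^ d * (t • (1 : Matrix (Fin d) (Fin d) ℝ)).det))⁻¹ *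
      Real.exp (-(1 / 2 : ℝ) * ((w - 0) ⬝ᵥ ((t • (1 : Matrix (Fin d) (Fin d) ℝ))⁻¹ *ᵥ (w - 0))))
      = ∏ i, gaussianPDFReal 0 t.toNNReal (w i) := by
    intro w
    rw [hinv]
    simp only [gaussianPDFReal, Finset.prod_mul_distrib, ← Real.exp_sum, Finset.prod_const,
      Finset.card_univ, Fintype.card_fin, hc]
    congr 1
    · rw [det_smul, det_one, mul_one, Fintype.card_fin, ← mul_pow, inv_pow]
      congr 1
      rw [Real.sqrt_eq_iff_mul_self_eq (by positivity) (by positivity), ← mul_pow,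
        Real.mul_self_sqrt (by positivity)]
    · congr 1
      simp only [sub_zero, smul_mulVec, one_mulVec, dotProduct, Pi.smul_apply, smul_eq_mul,
        Finset.mul_sum]
      refine Finset.sum_congr rfl fun i _ => ?_
      field_simp
  symm
  apply Measure.pi_eq
  intro s hs
  unfold gaussianMeasure
  rw [withDensity_apply _ (MeasurableSet.univ_pi hs)]
  simp_rw [hdens]
  rw [volume_pi, Measure.restrict_pi_pi, ← ofReal_integral_eq_lintegral_ofReal,
    integral_fintype_prod_eq_prod, ENNReal.ofReal_prod_of_nonneg]
  · refine Finset.prod_congr rfl fun i _ => ?_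
    rw [gaussianReal_apply_eq_integral _ hv]
  · intro i _
    exact integral_nonneg fun x => gaussianPDFReal_nonneg _ _ _
  · exact Integrable.fintype_prod_dep fun i => (integrable_gaussianPDFReal _ _).restrict
  · exact Filter.Eventually.of_forall fun w =>
      Finset.prod_nonneg fun i _ => gaussianPDFReal_nonneg _ _ _

open ProbabilityTheory in
lemma gaussian_moments {d : ℕ} (t : ℝ) (ht : 0 < t) :
    IsProbabilityMeasure (gaussianMeasure (0 : Fin d → ℝ) (t • (1 : Matrix (Fin d) (Fin d) ℝ))) ∧
    (∀ i, Integrable (fun w => w i) (gaussianMeasure (0 : Fin d → ℝ) (t • 1))) ∧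
    (∀ i, ∫ w, w i ∂(gaussianMeasure (0 : Fin d → ℝ) (t • 1)) = 0) ∧
    (∀ i j, Integrable (fun w => w i * w j) (gaussianMeasure (0 : Fin d → ℝ) (t • 1))) ∧
    (∀ i j, ∫ w, w i * w j ∂(gaussianMeasure (0 : Fin d → ℝ) (t • 1)) = if i = j then t else 0) := by
  rw [gaussianMeasure_eq_pi t ht]
  have hL : ∀ i, MemLp (fun w : Fin d → ℝ => w i) 2
      (Measure.pi (fun _ : Fin d => gaussianReal 0 t.toNNReal)) := fun i =>
    (memLp_id_gaussianReal' 2 (by simp)).comp_measurePreserving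
      (measurePreserving_eval (fun _ : Fin d => gaussianReal 0 t.toNNReal) i)
  have h1 : ∀ i, ∫ w : Fin d → ℝ, w i ∂(Measure.pi (fun _ : Fin d => gaussianReal 0 t.toNNReal))
      = 0 := by
    intro i
    rw [integral_comp_eval (μ := fun _ : Fin d => gaussianReal 0 t.toNNReal) (i := i)
      (f := fun x : ℝ => x) (by fun_prop)]
    exact integral_id_gaussianReal
  refine ⟨inferInstance, fun i => (hL i).integrable (by norm_num), h1,
    fun i j => (hL i).integrable_mul (hL j), ?_⟩
  intro i j
  split_ifs with hij
  · subst hij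
    rw [integral_comp_eval (μ := fun _ : Fin d => gaussianReal 0 t.toNNReal) (i := i)
      (f := fun x : ℝ => x * x) (by fun_prop)]
    have h := variance_id_gaussianReal (μ := 0) (v := t.toNNReal)
    rw [variance_eq_integral (by fun_prop)] at h
    simp [integral_id_gaussianReal, pow_two] at h
    rw [h, max_eq_left ht.le]
  · have hind : iIndepFun (fun i (w : Fin d → ℝ) => w i)
        (Measure.pi (fun _ : Fin d => gaussianReal 0 t.toNNReal)) :=
      iIndepFun_pi (X := fun _ x => x) (by fun_prop)
    rw [(hind.indepFun hij).integral_fun_mul_eq_mul_integral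
      (hL i).aestronglyMeasurable (hL j).aestronglyMeasurable, h1]
    simp

lemma gaussian_quad {n d : ℕ} (t : ℝ) (ht : 0 < t) (Λ : Matrix (Fin n) (Fin d) ℝ)
    (P : Matrix (Fin n) (Fin n) ℝ) (hP : P.IsSymm) (p : Fin n → ℝ) (r : ℝ) (μ : Fin n → ℝ) :
    ∫ w, ((1 / 2 : ℝ) * ((μ + Λ *ᵥ w) ⬝ᵥ (P *ᵥ (μ + Λ *ᵥ w))) + (μ + Λ *ᵥ w) ⬝ᵥ p + r)
      ∂(gaussianMeasure (0 : Fin d → ℝ) (t • (1 : Matrix (Fin d) (Fin d) ℝ)))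
    = (1 / 2 : ℝ) * (μ ⬝ᵥ (P *ᵥ μ)) + μ ⬝ᵥ p + r + (1 / 2 : ℝ) * (Λᵀ * P * Λ).trace * t := by
  obtain ⟨h0, hi1, h1, hi2, h2⟩ := gaussian_moments (d := d) t ht
  have key : ∀ w : Fin d → ℝ,
      (1 / 2 : ℝ) * ((μ + Λ *ᵥ w) ⬝ᵥ (P *ᵥ (μ + Λ *ᵥ w))) + (μ + Λ *ᵥ w) ⬝ᵥ p + r
      = ((1 / 2 : ℝ) * (μ ⬝ᵥ (P *ᵥ μ)) + μ ⬝ᵥ p + r)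
        + (∑ i, (Λᵀ *ᵥ (P *ᵥ μ + p)) i * w i
        + ∑ i, ∑ j, ((1 / 2 : ℝ) * (Λᵀ * P * Λ) i j) * (w i * w j)) := by
    intro w
    have e1 : ∑ i, (Λᵀ *ᵥ (P *ᵥ μ + p)) i * w i = (Λ *ᵥ w) ⬝ᵥ (P *ᵥ μ + p) := by
      change (Λᵀ *ᵥ (P *ᵥ μ + p)) ⬝ᵥ w = _
      rw [mulVec_transpose, ← dotProduct_mulVec, dotProduct_comm]
    have e2 : ∑ i, ∑ j, ((1 / 2 : ℝ) * (Λᵀ * P * Λ) i j) * (w i * w j)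
        = (1 / 2 : ℝ) * ((Λ *ᵥ w) ⬝ᵥ (P *ᵥ (Λ *ᵥ w))) := by
      have : (Λ *ᵥ w) ⬝ᵥ (P *ᵥ (Λ *ᵥ w)) = w ⬝ᵥ ((Λᵀ * P * Λ) *ᵥ w) := by
        rw [← mulVec_mulVec, ← mulVec_mulVec, dotProduct_comm w, mulVec_transpose,
          ← dotProduct_mulVec, dotProduct_comm]
      rw [this]
      simp only [dotProduct, mulVec, Finset.mul_sum]
      refine Finset.sum_congr rfl fun i _ => Finset.sum_congr rfl fun j _ => ?_
      ring
    have e3 : μ ⬝ᵥ (P *ᵥ (Λ *ᵥ w)) = (Λ *ᵥ w) ⬝ᵥ (P *ᵥ μ) := by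
      rw [dotProduct_mulVec, ← mulVec_transpose, hP.eq, dotProduct_comm]
    rw [e1, e2]
    simp only [mulVec_add, dotProduct_add, add_dotProduct, e3]
    ring
  have hI1 : Integrable (fun w : Fin d → ℝ => ∑ i, (Λᵀ *ᵥ (P *ᵥ μ + p)) i * w i)
      (gaussianMeasure (0 : Fin d → ℝ) (t • (1 : Matrix (Fin d) (Fin d) ℝ))) :=
    integrable_finsetSum _ fun i _ => (hi1 i).const_mul _
  have hI2 : Integrable (fun w : Fin d → ℝ =>
      ∑ i, ∑ j, ((1 / 2 : ℝ) * (Λᵀ * P * Λ) i j) * (w i * w j))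
      (gaussianMeasure (0 : Fin d → ℝ) (t • (1 : Matrix (Fin d) (Fin d) ℝ))) :=
    integrable_finsetSum _ fun i _ => integrable_finsetSum _ fun j _ => (hi2 i j).const_mul _
  simp_rw [key]
  rw [integral_add (integrable_const _) (by exact hI1.add hI2), integral_add hI1 hI2,
    integral_finsetSum _ (fun i _ => (hi1 i).const_mul _),
    integral_finsetSum _ (fun i _ => integrable_finsetSum _ fun j _ => (hi2 i j).const_mul _)]
  simp_rw [integral_finsetSum _ (fun j _ => (hi2 _ j).const_mul _), integral_const_mul, h1, h2]
  simp [Matrix.trace, Finset.mul_sum, Finset.sum_mul]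

lemma posDef_sub {m : ℕ} {M : Matrix (Fin m) (Fin m) ℝ} (hM : M.PosDef) : Mᵀ = M := by
  have := hM.isHermitian
  rwa [IsHermitian, conjTranspose_eq_transpose_of_trivial] at this

lemma posDef_nonneg {m : ℕ} {M : Matrix (Fin m) (Fin m) ℝ} (hM : M.PosDef) (x : Fin m → ℝ) :
    0 ≤ x ⬝ᵥ (M *ᵥ x) := by
  simpa using hM.posSemidef.dotProduct_mulVec_nonneg x

lemma posDef_mul_inv {m : ℕ} {M : Matrix (Fin m) (Fin m) ℝ} (hM : M.PosDef) (x : Fin m → ℝ) :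
    M *ᵥ (M⁻¹ *ᵥ x) = x := by
  rw [mulVec_mulVec, mul_nonsing_inv _ ((isUnit_iff_isUnit_det _).1 hM.isUnit), one_mulVec]

lemma symm_dot {m : ℕ} {M : Matrix (Fin m) (Fin m) ℝ} (hM : Mᵀ = M) (x y : Fin m → ℝ) :
    x ⬝ᵥ (M *ᵥ y) = y ⬝ᵥ (M *ᵥ x) := by
  rw [dotProduct_mulVec, ← mulVec_transpose, hM, dotProduct_comm]

lemma transp_dot {m n : ℕ} (M : Matrix (Fin m) (Fin n) ℝ) (x : Fin n → ℝ) (y : Fin m → ℝ) :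
    x ⬝ᵥ (Mᵀ *ᵥ y) = y ⬝ᵥ (M *ᵥ x) := by
  rw [dotProduct_mulVec y, ← mulVec_transpose, dotProduct_comm]

/-- Completing the square. -/
lemma quad_bound {m : ℕ} {M : Matrix (Fin m) (Fin m) ℝ} (hM : M.PosDef) (x y : Fin m → ℝ) :
    y ⬝ᵥ x - (1 / 2 : ℝ) * (x ⬝ᵥ (M *ᵥ x)) ≤ (1 / 2 : ℝ) * (y ⬝ᵥ (M⁻¹ *ᵥ y)) := by
  have h := posDef_nonneg hM (x - M⁻¹ *ᵥ y)
  simp only [mulVec_sub, posDef_mul_inv hM, sub_dotProduct, dotProduct_sub] at h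
  rw [symm_dot (posDef_sub hM) (M⁻¹ *ᵥ y) x, posDef_mul_inv hM] at h
  rw [dotProduct_comm (M⁻¹ *ᵥ y) y, dotProduct_comm x y] at h
  linarith

/-- The abstract one-step linear-quadratic game. -/
lemma game_value {m d : ℕ} (θ t : ℝ) (hθ : 0 < θ) (ht : 0 < t)
    (S : Matrix (Fin m) (Fin d) ℝ) (hS : (S * Sᵀ).PosDef)
    (N : Matrix (Fin d) (Fin d) ℝ) (hN : N.PosDef)
    (H : Matrix (Fin m) (Fin m) ℝ)
    (hM : (H - (θ * t) • (S * (1 + θ • N⁻¹) * Sᵀ)).PosDef)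
    (a : Fin m → ℝ) (y : Fin d → ℝ) (c₀ : ℝ) :
    ⨅ h : Fin m → ℝ, ⨆ q : (Fin d → ℝ) × (Fin m → ℝ),
      (θ * t * ((1 / 2 : ℝ) * ((h + q.2) ⬝ᵥ ((S * Sᵀ) *ᵥ (h + q.2))) - (h + q.2) ⬝ᵥ a
          - (h + q.2) ⬝ᵥ (S *ᵥ q.1)) + t * (q.1 ⬝ᵥ y) - (1 / 2 : ℝ) * t * (q.1 ⬝ᵥ (N *ᵥ q.1))
        + c₀ - (1 / 2 : ℝ) * (q.2 ⬝ᵥ (H *ᵥ q.2)))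
    = c₀ - (1 / 2 : ℝ) * θ * t * (a ⬝ᵥ ((S * Sᵀ)⁻¹ *ᵥ a))
      + (1 / 2 : ℝ) * t * ((y - θ • (Sᵀ *ᵥ ((S * Sᵀ)⁻¹ *ᵥ a))) ⬝ᵥ
        ((θ • (Sᵀ * (S * Sᵀ)⁻¹ * S) + N)⁻¹ *ᵥ (y - θ • (Sᵀ *ᵥ ((S * Sᵀ)⁻¹ *ᵥ a))))) := by
  have hB : (θ • (Sᵀ * (S * Sᵀ)⁻¹ * S) + N).PosDef := by
    refine PosDef.posSemidef_add ?_ hN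
    have h1 := hS.inv.posSemidef.conjTranspose_mul_mul_same S
    rw [conjTranspose_eq_transpose_of_trivial] at h1
    exact h1.smul hθ.le
  set L := y - θ • (Sᵀ *ᵥ ((S * Sᵀ)⁻¹ *ᵥ a)) with hL
  set γs := (θ • (Sᵀ * (S * Sᵀ)⁻¹ * S) + N)⁻¹ *ᵥ L with hγs
  set vs := (S * Sᵀ)⁻¹ *ᵥ (a + S *ᵥ γs) with hvs
  have hNs : Nᵀ = N := posDef_sub hN
  have hGs := posDef_sub hS
  have c1 : (S * Sᵀ) *ᵥ vs = a + S *ᵥ γs := posDef_mul_inv hS _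
  have c2 : N *ᵥ γs = y - θ • (Sᵀ *ᵥ vs) := by
    have h1 : (θ • (Sᵀ * (S * Sᵀ)⁻¹ * S) + N) *ᵥ γs = L := posDef_mul_inv hB _
    rw [add_mulVec, smul_mulVec, ← mulVec_mulVec, ← mulVec_mulVec, hL] at h1
    rw [hvs, mulVec_add, mulVec_add, smul_add, ← sub_sub, ← h1]
    abel
  have hval : θ * t * ((1 / 2 : ℝ) * (vs ⬝ᵥ ((S * Sᵀ) *ᵥ vs)) - vs ⬝ᵥ a - vs ⬝ᵥ (S *ᵥ γs))
      + t * (γs ⬝ᵥ y) - (1 / 2 : ℝ) * t * (γs ⬝ᵥ (N *ᵥ γs))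
      = - (1 / 2 : ℝ) * θ * t * (a ⬝ᵥ ((S * Sᵀ)⁻¹ *ᵥ a)) + (1 / 2 : ℝ) * t * (L ⬝ᵥ γs) := by
    have e1 : vs ⬝ᵥ a = a ⬝ᵥ ((S * Sᵀ)⁻¹ *ᵥ a) + γs ⬝ᵥ (Sᵀ *ᵥ ((S * Sᵀ)⁻¹ *ᵥ a)) := by
      rw [dotProduct_comm, hvs, mulVec_add, dotProduct_add, transp_dot,
        symm_dot (posDef_sub hS.inv) a (S *ᵥ γs), dotProduct_comm (S *ᵥ γs)]
    have e2 : L ⬝ᵥ γs = γs ⬝ᵥ y - θ * (γs ⬝ᵥ (Sᵀ *ᵥ ((S * Sᵀ)⁻¹ *ᵥ a))) := by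
      rw [dotProduct_comm, hL, dotProduct_sub, dotProduct_smul, smul_eq_mul]
    rw [c1, c2, e2, dotProduct_add, dotProduct_sub, dotProduct_smul, smul_eq_mul, transp_dot, e1]
    ring
  set V := c₀ - (1 / 2 : ℝ) * θ * t * (a ⬝ᵥ ((S * Sᵀ)⁻¹ *ᵥ a))
      + (1 / 2 : ℝ) * t * (L ⬝ᵥ γs) with hV
  -- expansion around the saddle point
  have hexpand : ∀ (δ : Fin m → ℝ) (ε : Fin d → ℝ),
      θ * t * ((1 / 2 : ℝ) * ((vs + δ) ⬝ᵥ ((S * Sᵀ) *ᵥ (vs + δ))) - (vs + δ) ⬝ᵥ a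
          - (vs + δ) ⬝ᵥ (S *ᵥ (γs + ε))) + t * ((γs + ε) ⬝ᵥ y)
          - (1 / 2 : ℝ) * t * ((γs + ε) ⬝ᵥ (N *ᵥ (γs + ε))) + c₀
      = V + θ * t * ((1 / 2 : ℝ) * (δ ⬝ᵥ ((S * Sᵀ) *ᵥ δ)) - δ ⬝ᵥ (S *ᵥ ε))
        - (1 / 2 : ℝ) * t * (ε ⬝ᵥ (N *ᵥ ε)) := by
    intro δ ε
    simp only [mulVec_add, dotProduct_add, add_dotProduct]
    rw [symm_dot hGs vs δ, symm_dot hNs γs ε]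
    have d1 : δ ⬝ᵥ ((S * Sᵀ) *ᵥ vs) = δ ⬝ᵥ a + δ ⬝ᵥ (S *ᵥ γs) := by rw [c1, dotProduct_add]
    have d2 : ε ⬝ᵥ (N *ᵥ γs) = ε ⬝ᵥ y - θ * (vs ⬝ᵥ (S *ᵥ ε)) := by
      rw [c2, dotProduct_sub, dotProduct_smul, smul_eq_mul, transp_dot]
    rw [d1, d2]
    linear_combination hval
  -- upper bound for all perturbations
  set Q := (θ * t) • (S * (1 + θ • N⁻¹) * Sᵀ) with hQ
  have hQv : ∀ δ : Fin m → ℝ, δ ⬝ᵥ (Q *ᵥ δ) = θ * t * (δ ⬝ᵥ ((S * Sᵀ) *ᵥ δ))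
      + θ ^ 2 * t * ((Sᵀ *ᵥ δ) ⬝ᵥ (N⁻¹ *ᵥ (Sᵀ *ᵥ δ))) := by
    intro δ
    rw [hQ, Matrix.mul_add, Matrix.add_mul, Matrix.mul_one]
    simp only [smul_mulVec, add_mulVec, dotProduct_smul, dotProduct_add, smul_eq_mul,
      Matrix.mul_smul, Matrix.smul_mul]
    have : δ ⬝ᵥ ((S * N⁻¹ * Sᵀ) *ᵥ δ) = (Sᵀ *ᵥ δ) ⬝ᵥ (N⁻¹ *ᵥ (Sᵀ *ᵥ δ)) := by
      rw [← mulVec_mulVec, ← mulVec_mulVec, dotProduct_mulVec, ← mulVec_transpose]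
    rw [this]
    ring
  have hQs : Qᵀ = Q := by
    rw [hQ, transpose_smul, transpose_mul, transpose_mul, transpose_transpose, transpose_add,
      transpose_smul, posDef_sub hN.inv, transpose_one, Matrix.mul_assoc]
  have hup : ∀ (δ : Fin m → ℝ) (ε : Fin d → ℝ),
      θ * t * ((1 / 2 : ℝ) * (δ ⬝ᵥ ((S * Sᵀ) *ᵥ δ)) - δ ⬝ᵥ (S *ᵥ ε))
        - (1 / 2 : ℝ) * t * (ε ⬝ᵥ (N *ᵥ ε)) ≤ (1 / 2 : ℝ) * (δ ⬝ᵥ (Q *ᵥ δ)) := by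
    intro δ ε
    have h1 := quad_bound hN ε (-(θ • (Sᵀ *ᵥ δ)))
    simp only [neg_dotProduct, mulVec_neg, mulVec_smul, smul_dotProduct, dotProduct_smul,
      dotProduct_neg, smul_eq_mul] at h1
    rw [dotProduct_comm (Sᵀ *ᵥ δ) ε, transp_dot] at h1
    have h2 := mul_le_mul_of_nonneg_left h1 ht.le
    rw [hQv]
    nlinarith [h2]
  have hub : ∀ (h : Fin m → ℝ) (q : (Fin d → ℝ) × (Fin m → ℝ)),
      (θ * t * ((1 / 2 : ℝ) * ((h + q.2) ⬝ᵥ ((S * Sᵀ) *ᵥ (h + q.2))) - (h + q.2) ⬝ᵥ a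
          - (h + q.2) ⬝ᵥ (S *ᵥ q.1)) + t * (q.1 ⬝ᵥ y) - (1 / 2 : ℝ) * t * (q.1 ⬝ᵥ (N *ᵥ q.1))
        + c₀ - (1 / 2 : ℝ) * (q.2 ⬝ᵥ (H *ᵥ q.2)))
      ≤ V + (1 / 2 : ℝ) * ((h - vs) ⬝ᵥ (Q *ᵥ (h - vs)))
        + ((Q *ᵥ (h - vs)) ⬝ᵥ q.2 - (1 / 2 : ℝ) * (q.2 ⬝ᵥ ((H - Q) *ᵥ q.2))) := by
    intro h q
    have h1 := hexpand (h - vs + q.2) (q.1 - γs)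
    have h2 := hup (h - vs + q.2) (q.1 - γs)
    rw [show vs + (h - vs + q.2) = h + q.2 by abel, show γs + (q.1 - γs) = q.1 by abel] at h1
    rw [h1]
    have h3 : (h - vs + q.2) ⬝ᵥ (Q *ᵥ (h - vs + q.2)) = (h - vs) ⬝ᵥ (Q *ᵥ (h - vs))
        + 2 * ((Q *ᵥ (h - vs)) ⬝ᵥ q.2) + q.2 ⬝ᵥ (Q *ᵥ q.2) := by
      rw [mulVec_add, add_dotProduct, dotProduct_add, dotProduct_add,
        symm_dot hQs (h - vs) q.2, dotProduct_comm (Q *ᵥ (h - vs)) q.2]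
      ring
    rw [h3] at h2
    rw [sub_mulVec, dotProduct_sub]
    linarith
  have hbdd : ∀ h : Fin m → ℝ, BddAbove (Set.range fun q : (Fin d → ℝ) × (Fin m → ℝ) =>
      (θ * t * ((1 / 2 : ℝ) * ((h + q.2) ⬝ᵥ ((S * Sᵀ) *ᵥ (h + q.2))) - (h + q.2) ⬝ᵥ a
          - (h + q.2) ⬝ᵥ (S *ᵥ q.1)) + t * (q.1 ⬝ᵥ y) - (1 / 2 : ℝ) * t * (q.1 ⬝ᵥ (N *ᵥ q.1))
        + c₀ - (1 / 2 : ℝ) * (q.2 ⬝ᵥ (H *ᵥ q.2)))) := by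
    intro h
    refine ⟨V + (1 / 2 : ℝ) * ((h - vs) ⬝ᵥ (Q *ᵥ (h - vs))) +
      (1 / 2 : ℝ) * ((Q *ᵥ (h - vs)) ⬝ᵥ ((H - Q)⁻¹ *ᵥ (Q *ᵥ (h - vs)))), ?_⟩
    rintro _ ⟨q, rfl⟩
    refine (hub h q).trans ?_
    have := quad_bound hM q.2 (Q *ᵥ (h - vs))
    linarith
  have hlow : ∀ h : Fin m → ℝ, V ≤ ⨆ q : (Fin d → ℝ) × (Fin m → ℝ),
      (θ * t * ((1 / 2 : ℝ) * ((h + q.2) ⬝ᵥ ((S * Sᵀ) *ᵥ (h + q.2))) - (h + q.2) ⬝ᵥ a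
          - (h + q.2) ⬝ᵥ (S *ᵥ q.1)) + t * (q.1 ⬝ᵥ y) - (1 / 2 : ℝ) * t * (q.1 ⬝ᵥ (N *ᵥ q.1))
        + c₀ - (1 / 2 : ℝ) * (q.2 ⬝ᵥ (H *ᵥ q.2))) := by
    intro h
    refine le_trans ?_ (le_ciSup (hbdd h) (γs, 0))
    have h1 := hexpand (h - vs) 0
    rw [show vs + (h - vs) = h by abel] at h1
    simp only [add_zero, mulVec_zero, dotProduct_zero, mul_zero, sub_zero] at h1 ⊢
    rw [h1]
    have := posDef_nonneg hS (h - vs)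
    have : 0 ≤ θ * t * (1 / 2 * ((h - vs) ⬝ᵥ ((S * Sᵀ) *ᵥ (h - vs)))) := by positivity
    linarith
  apply le_antisymm
  · refine (ciInf_le ⟨V, ?_⟩ vs).trans (ciSup_le fun q => (hub vs q).trans ?_)
    · rintro _ ⟨h, rfl⟩
      exact hlow h
    · have := posDef_nonneg hM q.2
      simp only [sub_self, mulVec_zero, dotProduct_zero, zero_dotProduct]
      linarith
  · exact le_ciInf hlow

lemma body_eq {m n d : ℕ} (θ Δt : ℝ) (hθ : 0 < θ) (hΔt : 0 < Δt)
    (S : Matrix (Fin m) (Fin d) ℝ)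
    (A : Matrix (Fin m) (Fin n) ℝ) (a : Fin m → ℝ) (Ξ : Fin d → ℝ)
    (Λ : Matrix (Fin n) (Fin d) ℝ)
    (c : ℝ) (C : Fin n → ℝ) (Ψ : Matrix (Fin m) (Fin m) ℝ)
    (P : Matrix (Fin n) (Fin n) ℝ) (hP : P.IsSymm) (p : Fin n → ℝ) (r T : ℝ)
    (x ν : Fin n → ℝ) (h η : Fin m → ℝ) (γ : Fin d → ℝ) :
    θ * gFun θ Δt S A a Ξ c C Ψ x h η γ * Δt
      + ((1 / 2 : ℝ) * ((ν + Δt • (Λ *ᵥ γ)) ⬝ᵥ (P *ᵥ (ν + Δt • (Λ *ᵥ γ))))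
        + (ν + Δt • (Λ *ᵥ γ)) ⬝ᵥ p + r + T)
    = θ * Δt * ((1 / 2 : ℝ) * ((h + η) ⬝ᵥ ((S * Sᵀ) *ᵥ (h + η))) - (h + η) ⬝ᵥ (a + A *ᵥ x)
          - (h + η) ⬝ᵥ (S *ᵥ γ)) + Δt * (γ ⬝ᵥ (θ • Ξ + Λᵀ *ᵥ (P *ᵥ ν + p)))
        - (1 / 2 : ℝ) * Δt * (γ ⬝ᵥ ((-(Δt • (Λᵀ * P * Λ) - 1)) *ᵥ γ))
        + (θ * Δt * ((1 / 2 : ℝ) * (Ψ * (S * Sᵀ)).trace - (1 / 2 : ℝ) * (Ξ ⬝ᵥ Ξ) + c + C ⬝ᵥ x)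
            + ((1 / 2 : ℝ) * (ν ⬝ᵥ (P *ᵥ ν)) + ν ⬝ᵥ p + r + T))
        - (1 / 2 : ℝ) * (η ⬝ᵥ (Ψ⁻¹ *ᵥ η)) := by
  have hR : γ ⬝ᵥ ((Λᵀ * P * Λ) *ᵥ γ) = (Λ *ᵥ γ) ⬝ᵥ (P *ᵥ (Λ *ᵥ γ)) := by
    rw [← mulVec_mulVec, ← mulVec_mulVec, transp_dot, dotProduct_comm]
  have h1 : ((h + η) ᵥ* A) ⬝ᵥ x = (h + η) ⬝ᵥ (A *ᵥ x) := (dotProduct_mulVec _ _ _).symm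
  have h2 : (Sᵀ *ᵥ (h + η)) ⬝ᵥ γ = (h + η) ⬝ᵥ (S *ᵥ γ) := by
    rw [dotProduct_comm, transp_dot]
  have h3 : γ ⬝ᵥ (Λᵀ *ᵥ (P *ᵥ ν + p)) = (Λ *ᵥ γ) ⬝ᵥ (P *ᵥ ν) + (Λ *ᵥ γ) ⬝ᵥ p := by
    rw [transp_dot, dotProduct_comm, dotProduct_add]
  have h4 : ν ⬝ᵥ (P *ᵥ (Λ *ᵥ γ)) = (Λ *ᵥ γ) ⬝ᵥ (P *ᵥ ν) := symm_dot hP.eq _ _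
  unfold gFun
  rw [neg_sub, sub_mulVec, one_mulVec, smul_mulVec, dotProduct_sub, dotProduct_smul, hR,
    sub_dotProduct _ C, h1, sub_dotProduct _ Ξ, h2, dotProduct_add γ, h3,
    dotProduct_add (h + η) a]
  generalize h + η = v
  simp only [mulVec_add, mulVec_smul, add_dotProduct, dotProduct_add, smul_dotProduct, dotProduct_smul, smul_eq_mul, h4, dotProduct_comm γ Ξ]
  field_simp
  ring

lemma quad_id {m n d : ℕ} (θ Δt : ℝ) (hΔt : 0 < Δt)
    (S : Matrix (Fin m) (Fin d) ℝ) (hS : (S * Sᵀ).PosDef)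
    (A : Matrix (Fin m) (Fin n) ℝ) (a : Fin m → ℝ) (Ξ : Fin d → ℝ)
    (Λ : Matrix (Fin n) (Fin d) ℝ) (b : Fin n → ℝ) (Bt : Matrix (Fin n) (Fin n) ℝ)
    (c : ℝ) (C : Fin n → ℝ) (Ψ : Matrix (Fin m) (Fin m) ℝ)
    (P : Matrix (Fin n) (Fin n) ℝ) (hP : P.IsSymm) (p : Fin n → ℝ) (r : ℝ)
    (hB : (calB θ Δt S Λ P)ᵀ = calB θ Δt S Λ P)
    (x : Fin n → ℝ) :
    (θ * Δt * ((1 / 2 : ℝ) * (Ψ * (S * Sᵀ)).trace - (1 / 2 : ℝ) * (Ξ ⬝ᵥ Ξ) + c + C ⬝ᵥ x)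
      + ((1 / 2 : ℝ) * ((Δt • b + Bt *ᵥ x) ⬝ᵥ (P *ᵥ (Δt • b + Bt *ᵥ x)))
        + (Δt • b + Bt *ᵥ x) ⬝ᵥ p + r + (1 / 2 : ℝ) * (Λᵀ * P * Λ).trace * Δt))
      - (1 / 2 : ℝ) * θ * Δt * ((a + A *ᵥ x) ⬝ᵥ ((S * Sᵀ)⁻¹ *ᵥ (a + A *ᵥ x)))
      + (1 / 2 : ℝ) * Δt *
        (((θ • Ξ + Λᵀ *ᵥ (P *ᵥ (Δt • b + Bt *ᵥ x) + p))
            - θ • (Sᵀ *ᵥ ((S * Sᵀ)⁻¹ *ᵥ (a + A *ᵥ x)))) ⬝ᵥ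
        ((calB θ Δt S Λ P)⁻¹ *ᵥ ((θ • Ξ + Λᵀ *ᵥ (P *ᵥ (Δt • b + Bt *ᵥ x) + p))
            - θ • (Sᵀ *ᵥ ((S * Sᵀ)⁻¹ *ᵥ (a + A *ᵥ x))))))
    = (1 / 2 : ℝ) * (x ⬝ᵥ (((1 / 2 : ℝ) •
        (Pstep θ Δt S A Λ Bt P + (Pstep θ Δt S A Λ Bt P)ᵀ)) *ᵥ x))
      + x ⬝ᵥ pstep θ Δt S A a Ξ Λ b Bt C P p + rstep θ Δt S a Ξ Λ b c Ψ P p r := by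
  have hGi : ((S * Sᵀ)⁻¹)ᵀ = (S * Sᵀ)⁻¹ := posDef_sub hS.inv
  have hBi : ((calB θ Δt S Λ P)⁻¹)ᵀ = (calB θ Δt S Λ P)⁻¹ := by
    rw [transpose_nonsing_inv, hB]
  have hsym : x ⬝ᵥ (((1 / 2 : ℝ) •
        (Pstep θ Δt S A Λ Bt P + (Pstep θ Δt S A Λ Bt P)ᵀ)) *ᵥ x)
      = x ⬝ᵥ (Pstep θ Δt S A Λ Bt P *ᵥ x) := by
    rw [smul_mulVec, add_mulVec, dotProduct_smul, dotProduct_add, transp_dot, smul_eq_mul]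
    ring
  rw [hsym]
  unfold Pstep pstep rstep
  generalize (calB θ Δt S Λ P)⁻¹ = Bi at *
  generalize (S * Sᵀ)⁻¹ = Gi at *
  have mA : ∀ z, x ⬝ᵥ (Aᵀ *ᵥ z) = (A *ᵥ x) ⬝ᵥ z := fun z => by rw [transp_dot, dotProduct_comm]
  have mB : ∀ z, x ⬝ᵥ (Btᵀ *ᵥ z) = (Bt *ᵥ x) ⬝ᵥ z := fun z => by rw [transp_dot, dotProduct_comm]
  have mG : ∀ y z, y ⬝ᵥ (Gi *ᵥ z) = (Gi *ᵥ y) ⬝ᵥ z := fun y z => by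
    rw [symm_dot hGi, dotProduct_comm]
  have mP : ∀ y z, y ⬝ᵥ (P *ᵥ z) = (P *ᵥ y) ⬝ᵥ z := fun y z => by
    rw [symm_dot hP.eq, dotProduct_comm]
  have mS : ∀ y z, y ⬝ᵥ (S *ᵥ z) = (Sᵀ *ᵥ y) ⬝ᵥ z := fun y z => by
    rw [dotProduct_comm (Sᵀ *ᵥ y), transp_dot]
  have mL : ∀ y z, y ⬝ᵥ (Λ *ᵥ z) = (Λᵀ *ᵥ y) ⬝ᵥ z := fun y z => by
    rw [dotProduct_comm (Λᵀ *ᵥ y), transp_dot]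
  set z1 := Sᵀ *ᵥ (Gi *ᵥ (A *ᵥ x)) with hz1
  set z2 := Λᵀ *ᵥ (P *ᵥ (Bt *ᵥ x)) with hz2
  set L0 := (-θ) • (Sᵀ *ᵥ (Gi *ᵥ a)) + Λᵀ *ᵥ (Δt • (P *ᵥ b) + p) + θ • Ξ with hL0
  have eL : (θ • Ξ + Λᵀ *ᵥ (P *ᵥ (Δt • b + Bt *ᵥ x) + p)) - θ • (Sᵀ *ᵥ (Gi *ᵥ (a + A *ᵥ x)))
      = L0 + (z2 - θ • z1) := by
    rw [hL0, hz1, hz2]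
    simp only [mulVec_add, mulVec_smul, smul_add, neg_smul]
    abel
  have er1 : (-θ) • (a ᵥ* (Gi * S)) + Δt • (b ᵥ* (P * Λ)) + (p ᵥ* Λ) + θ • Ξ = L0 := by
    rw [hL0, ← mulVec_transpose, ← mulVec_transpose, ← mulVec_transpose, transpose_mul,
      transpose_mul, hGi, hP.eq, ← mulVec_mulVec, ← mulVec_mulVec, mulVec_add, mulVec_smul]
    abel
  have er2 : (-θ) • (Sᵀ *ᵥ (Gi *ᵥ a)) + Δt • (Λᵀ *ᵥ (P *ᵥ b)) + Λᵀ *ᵥ p + θ • Ξ = L0 := by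
    rw [hL0, mulVec_add, mulVec_smul]
    abel
  have eP : x ⬝ᵥ (((-(θ * Δt)) • (Aᵀ * Gi * A)
    + (θ ^ 2 * Δt) • (Aᵀ * Gi * S * Bi * Sᵀ * Gi * A)
    - (2 * θ * Δt) • (Aᵀ * Gi * S * Bi * Λᵀ * P * Bt)
    + Δt • (Btᵀ * P * Λ * Bi * Λᵀ * P * Bt)
    + Btᵀ * P * Bt) *ᵥ x) = -(θ * Δt) * ((Gi *ᵥ (A *ᵥ x)) ⬝ᵥ (A *ᵥ x))
      + (θ ^ 2 * Δt) * (z1 ⬝ᵥ (Bi *ᵥ z1)) - (2 * θ * Δt) * (z1 ⬝ᵥ (Bi *ᵥ z2))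
      + Δt * (z2 ⬝ᵥ (Bi *ᵥ z2)) + (P *ᵥ (Bt *ᵥ x)) ⬝ᵥ (Bt *ᵥ x) := by
    simp only [add_mulVec, sub_mulVec, smul_mulVec, dotProduct_add, dotProduct_sub,
      dotProduct_smul, smul_eq_mul, ← mulVec_mulVec, mA, mB, mG, mP, mS, mL, hz1, hz2]
  have ep : x ⬝ᵥ ((-(θ * Δt)) • (Aᵀ *ᵥ (Gi *ᵥ a))
    + Δt • ((((-θ) • (Aᵀ * Gi * S)) + Btᵀ * P * Λ) *ᵥ (Bi *ᵥ L0))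
    + Δt • (Btᵀ *ᵥ (P *ᵥ b + Δt⁻¹ • p) + θ • C))
    = -(θ * Δt) * ((Gi *ᵥ (A *ᵥ x)) ⬝ᵥ a) + Δt * (-θ * (z1 ⬝ᵥ (Bi *ᵥ L0)) + z2 ⬝ᵥ (Bi *ᵥ L0))
      + Δt * ((P *ᵥ (Bt *ᵥ x)) ⬝ᵥ b + Δt⁻¹ * ((Bt *ᵥ x) ⬝ᵥ p) + θ * (x ⬝ᵥ C)) := by
    clear_value L0
    simp only [add_mulVec, smul_mulVec, dotProduct_add, mulVec_add, mulVec_smul,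
      dotProduct_smul, smul_eq_mul, ← mulVec_mulVec, mA, mB, mG, mP, mS, mL, hz1, hz2]
  rw [eL, er1, er2, eP, ep]
  clear_value L0 z1 z2
  have s1 : L0 ⬝ᵥ (Bi *ᵥ z1) = z1 ⬝ᵥ (Bi *ᵥ L0) := symm_dot hBi _ _
  have s2 : L0 ⬝ᵥ (Bi *ᵥ z2) = z2 ⬝ᵥ (Bi *ᵥ L0) := symm_dot hBi _ _
  have s3 : z2 ⬝ᵥ (Bi *ᵥ z1) = z1 ⬝ᵥ (Bi *ᵥ z2) := symm_dot hBi _ _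
  have s4 : (Gi *ᵥ a) ⬝ᵥ (A *ᵥ x) = (Gi *ᵥ (A *ᵥ x)) ⬝ᵥ a := by rw [← mG, dotProduct_comm]
  have s5 : (P *ᵥ b) ⬝ᵥ (Bt *ᵥ x) = (P *ᵥ (Bt *ᵥ x)) ⬝ᵥ b := by rw [← mP, dotProduct_comm]
  simp only [mulVec_add, mulVec_sub, mulVec_smul, dotProduct_add, add_dotProduct, dotProduct_sub,
    sub_dotProduct, smul_dotProduct, dotProduct_smul, smul_eq_mul, s1, s2, s3, mG, mP, s4, s5,
    dotProduct_comm C x]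
  field_simp
  ring

/-- Main theorem: the dynamic-programming value of the relative-entropy-penalized LQG
game is quadratic, `u_k(x) = (1/2)xᵀP_kx + xᵀp_k + r_k`, with `(P_k, p_k, r_k)` given by
the explicit backward recursions. -/
theorem value_function_is_quadratic {m n d : ℕ} (K : ℕ) (hK : 1 ≤ K)
    (θ Δt : ℝ) (hθ : 0 < θ) (hΔt : 0 < Δt)
    (S : Matrix (Fin m) (Fin d) ℝ) (hS : (S * Sᵀ).PosDef)
    (A : Matrix (Fin m) (Fin n) ℝ) (a : Fin m → ℝ) (Ξ : Fin d → ℝ)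
    (Λ : Matrix (Fin n) (Fin d) ℝ) (b : Fin n → ℝ) (Bt : Matrix (Fin n) (Fin n) ℝ)
    (c : ℝ) (C : Fin n → ℝ)
    (Ψ : ℕ → Matrix (Fin m) (Fin m) ℝ) (hΨ : ∀ k < K, (Ψ k).PosDef)
    (P : ℕ → Matrix (Fin n) (Fin n) ℝ) (p : ℕ → Fin n → ℝ) (r : ℕ → ℝ)
    (hPsymm : ∀ k, (P k).IsSymm)
    (hPK : P K = 0) (hpK : p K = 0) (hrK : r K = 0)
    (hPrec : ∀ k < K, P k =
      (1 / 2 : ℝ) • (Pstep θ Δt S A Λ Bt (P (k + 1)) + (Pstep θ Δt S A Λ Bt (P (k + 1)))ᵀ))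
    (hprec : ∀ k < K, p k = pstep θ Δt S A a Ξ Λ b Bt C (P (k + 1)) (p (k + 1)))
    (hrrec : ∀ k < K, r k = rstep θ Δt S a Ξ Λ b c (Ψ k) (P (k + 1)) (p (k + 1)) (r (k + 1)))
    (h𝒜 : ∀ k < K,
      (-(Δt • (Λᵀ * P (k + 1) * Λ) - (1 : Matrix (Fin d) (Fin d) ℝ))).PosDef)
    (hexp : ∀ k < K,
      ((Ψ k)⁻¹ - (θ * Δt) •
        (S * ((1 : Matrix (Fin d) (Fin d) ℝ)
              - θ • (Δt • (Λᵀ * P (k + 1) * Λ) - (1 : Matrix (Fin d) (Fin d) ℝ))⁻¹)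
          * Sᵀ)).PosDef)
    (u : ℕ → (Fin n → ℝ) → ℝ)
    (huK : ∀ x, u K x = 0)
    (hu : ∀ k < K, ∀ x : Fin n → ℝ,
      u k x = ⨅ h : Fin m → ℝ, ⨆ q : (Fin d → ℝ) × (Fin m → ℝ),
        (θ * gFun θ Δt S A a Ξ c C (Ψ k) x h q.2 q.1 * Δt
          + ∫ w, u (k + 1) (Δt • b + Bt *ᵥ x + Δt • (Λ *ᵥ q.1) + Λ *ᵥ w)
              ∂(gaussianMeasure (0 : Fin d → ℝ) (Δt • (1 : Matrix (Fin d) (Fin d) ℝ))))) :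
    ∀ k ≤ K, ∀ x : Fin n → ℝ,
      u k x = (1 / 2 : ℝ) * (x ⬝ᵥ (P k *ᵥ x)) + x ⬝ᵥ p k + r k := by
  intro k hk
  induction hk using Nat.decreasingInduction with
  | self => intro x; simp [huK, hPK, hpK, hrK]
  | of_succ k hk ih =>
    intro x
    have hN := h𝒜 k hk
    have hinv : (-(Δt • (Λᵀ * P (k + 1) * Λ) - (1 : Matrix (Fin d) (Fin d) ℝ)))⁻¹
        = -(Δt • (Λᵀ * P (k + 1) * Λ) - (1 : Matrix (Fin d) (Fin d) ℝ))⁻¹ := by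
      have hu1 : IsUnit (Δt • (Λᵀ * P (k + 1) * Λ) - (1 : Matrix (Fin d) (Fin d) ℝ)) := by
        simpa using hN.isUnit.neg
      apply inv_eq_right_inv
      rw [neg_mul_neg, mul_nonsing_inv _ ((isUnit_iff_isUnit_det _).1 hu1)]
    have hM := hexp k hk
    rw [sub_eq_add_neg 1, ← smul_neg, ← hinv] at hM
    have hcalB : θ • (Sᵀ * (S * Sᵀ)⁻¹ * S)
        + -(Δt • (Λᵀ * P (k + 1) * Λ) - (1 : Matrix (Fin d) (Fin d) ℝ))
        = calB θ Δt S Λ (P (k + 1)) := by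
      rw [calB, ← sub_eq_add_neg]
    have hBs : (calB θ Δt S Λ (P (k + 1)))ᵀ = calB θ Δt S Λ (P (k + 1)) := by
      rw [← hcalB, transpose_add, posDef_sub hN, transpose_smul, transpose_mul, transpose_mul,
        transpose_transpose, posDef_sub hS.inv, ← Matrix.mul_assoc]
    have hgauss : ∀ γ : Fin d → ℝ,
        ∫ w, u (k + 1) (Δt • b + Bt *ᵥ x + Δt • (Λ *ᵥ γ) + Λ *ᵥ w)
          ∂(gaussianMeasure (0 : Fin d → ℝ) (Δt • (1 : Matrix (Fin d) (Fin d) ℝ)))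
        = _ := fun γ => by
      simp_rw [ih]
      exact gaussian_quad Δt hΔt Λ (P (k + 1)) (hPsymm _) (p (k + 1)) (r (k + 1))
        (Δt • b + Bt *ᵥ x + Δt • (Λ *ᵥ γ))
    rw [hu k hk x]
    simp_rw [hgauss, body_eq θ Δt hθ hΔt S A a Ξ Λ c C (Ψ k) (P (k + 1)) (hPsymm _)]
    rw [game_value θ Δt hθ hΔt S hS _ hN _ hM, hcalB, hPrec k hk, hprec k hk, hrrec k hk]
    exact quad_id θ Δt hΔt S hS A a Ξ Λ b Bt c C (Ψ k) (P (k + 1)) (hPsymm _) (p (k + 1))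
      (r (k + 1)) hBs x
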